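/- Let Y be a finite type of cardinality C ≥ 2 (the set of class labels), let N ≥ 1 be an integer, and let y, ỹ : Fin N → Y be the true and given labels of N instances. Let η = |{n : ỹ n ≠ y n}| / N be the noise rate of the given labels. For each n, let ȳ_n be drawn from the uniform probability mass function on Y \ {ỹ n}. Then the average over n of the probability that ȳ_n ≠ y n equals 1 − η/(C − 1). -/

import Mathlib

open scoped ENNReal

/-- Expected noise rate of the corrupted dataset: with `C` classes, `N` instances with
true labels `y` and given labels `yTilde`, noise rate `η = |{n : yTilde n ≠ y n}| / N`, and each
corrupted label `ȳ_n` drawn uniformly from the labels other than `yTilde n`, the average over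
`n` of the probability that `ȳ_n ≠ y n` equals `1 - η/(C-1)`. -/
theorem average_corrupted_mislabel_probability {Y : Type*} [Fintype Y] [DecidableEq Y]
    (hC : 2 ≤ Fintype.card Y) (N : ℕ) (hN : 1 ≤ N) (y yTilde : Fin N → Y)
    (hs : ∀ n : Fin N, (({yTilde n} : Finset Y)ᶜ).Nonempty)
    (η : ℝ) (hη : η = ((Finset.univ.filter fun n : Fin N => yTilde n ≠ y n).card : ℝ) / N) :
    (∑ n : Fin N,
        ((PMF.uniformOfFinset (({yTilde n} : Finset Y)ᶜ) (hs n)).toOuterMeasure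
          {z | z ≠ y n}).toReal) / (N : ℝ)
      = 1 - η / ((Fintype.card Y : ℝ) - 1) := by
  have hC' : (1 : ℝ) ≤ (Fintype.card Y : ℝ) - 1 := by
    have : (2 : ℝ) ≤ (Fintype.card Y : ℝ) := by exact_mod_cast hC
    linarith
  have hN' : (N : ℝ) ≠ 0 := by
    have : N ≠ 0 := by omega
    exact_mod_cast this
  have hc : ∀ a : Y, (((({a} : Finset Y)ᶜ).card : ℕ) : ℝ) = (Fintype.card Y : ℝ) - 1 := by
    intro a
    rw [Finset.card_compl, Finset.card_singleton, Nat.cast_sub (by omega), Nat.cast_one]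
  have key : ∀ n : Fin N,
      ((PMF.uniformOfFinset (({yTilde n} : Finset Y)ᶜ) (hs n)).toOuterMeasure
          {z | z ≠ y n}).toReal
        = 1 - (if yTilde n ≠ y n then (1 : ℝ) else 0) / ((Fintype.card Y : ℝ) - 1) := by
    intro n
    rw [PMF.toOuterMeasure_uniformOfFinset_apply, ENNReal.toReal_div, ENNReal.toReal_natCast,
      ENNReal.toReal_natCast, hc]
    have hcard : ((((({yTilde n} : Finset Y)ᶜ).erase (y n)).card : ℕ) : ℝ)
        = (Fintype.card Y : ℝ) - 1 - (if yTilde n ≠ y n then (1 : ℝ) else 0) := by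
      by_cases h : yTilde n = y n
      · rw [Finset.erase_eq_of_notMem (by simp [h]), hc]
        simp [h]
      · have hm : y n ∈ (({yTilde n} : Finset Y)ᶜ) := by
          simpa using fun h' => h h'.symm
        have := Finset.card_erase_add_one hm
        have h2 := hc (yTilde n)
        rw [← this] at h2
        push_cast at h2
        simp only [ne_eq, h, not_false_eq_true, if_true]
        linarith
    have hfc : ∀ s : Finset Y, s = (({yTilde n} : Finset Y)ᶜ).erase (y n) →
        ((s.card : ℕ) : ℝ) / ((Fintype.card Y : ℝ) - 1)
          = 1 - (if yTilde n ≠ y n then (1 : ℝ) else 0) / ((Fintype.card Y : ℝ) - 1) := by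
      rintro s rfl
      rw [hcard, sub_div, div_self (by linarith)]
    apply hfc
    ext z
    simp [and_comm]
  rw [Finset.sum_congr rfl fun n _ => key n, Finset.sum_sub_distrib, ← Finset.sum_div,
    Finset.sum_boole, hη]
  have : (Fintype.card Y : ℝ) - 1 ≠ 0 := by linarith
  simp only [Finset.sum_const, Finset.card_univ, Fintype.card_fin, nsmul_eq_mul, mul_one]
  field_simp
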